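/- Let (Γ,γ) be a connected 5-colored graph representing a singular 4-manifold N⁴. Then for each cyclic permutation ε of Δ₄: χ(N⁴) = 2 - 2ρ_ε(Γ) + Σ_{i∈Δ₄} ρ_ε(Γ_{ε̂_i}), where χ is the Euler characteristic and Γ_{ε̂_i} is the subgraph deleting ε_i-colored edges. -/

import Mathlib

open scoped Classical

namespace Cryst

/-- A `(d+1)`-regular properly edge-colored multigraph with color set `C`:
each vertex has exactly one edge of each color, encoded as a fixed-point-free
involution for each color. -/
structure CGraph (C : Type) where
  V : Type
  finV : Finite V
  edge : V → C → V
  invol : ∀ v c, edge (edge v c) c = v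
  no_loop : ∀ v c, edge v c ≠ v

attribute [instance] CGraph.finV

variable {C : Type}

/-- One-step adjacency in the subgraph keeping only the edges colored by `B`. -/
def step (G : CGraph C) (B : Set C) (v w : G.V) : Prop := ∃ c ∈ B, G.edge v c = w

/-- Reachability in the subgraph keeping only the edges colored by `B`. -/
def reaches (G : CGraph C) (B : Set C) : G.V → G.V → Prop :=
  Relation.ReflTransGen (step G B)

/-- The number `g_B` of connected components of the subgraph with colors in `B`. -/
noncomputable def gB (G : CGraph C) (B : Set C) : ℕ := Nat.card (Quot (step G B))

def Connected (G : CGraph C) : Prop :=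
  Nonempty G.V ∧ ∀ v w : G.V, reaches G Set.univ v w

def Bipartite (G : CGraph C) : Prop :=
  ∃ f : G.V → Bool, ∀ v c, f (G.edge v c) ≠ f v

/-- The (unordered) pair of cyclically consecutive colors at position `j` of the list `L`. -/
def pairSet (L : List C) (j : ℕ) : Set C :=
  {c | L[j % L.length]? = some c ∨ L[(j + 1) % L.length]? = some c}

/-- The regular genus of the subgraph of `G` colored by the entries of the list `L`,
with respect to the cyclic order given by `L` (summed over connected components):
it is defined by `2 g - 2 ρ = Σ_j g_{L_j, L_{j+1}} + (2 - n) p`, where `n` is the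
number of colors in `L`, `2p` the number of vertices and `g` the number of
connected components of the `L`-colored subgraph. -/
noncomputable def rhoL (G : CGraph C) (L : List C) : ℚ :=
  (gB G {c | c ∈ L} : ℚ) -
    ((∑ j ∈ Finset.range L.length, (gB G (pairSet L j) : ℚ)) +
      (2 - (L.length : ℚ)) * ((Nat.card G.V : ℚ) / 2)) / 2

/-- The listing of the colors determined by a permutation (a "cyclic permutation"
of the color set). -/
def permList {n : ℕ} (ε : Equiv.Perm (Fin n)) : List (Fin n) :=
  (List.finRange n).map ε

/-- The gluing relation defining the pseudocomplex associated to a colored graph: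
take one `d`-simplex per vertex of the graph and glue the facets opposite to the
vertex labelled `c` of the simplices corresponding to `c`-adjacent vertices. -/
def glueRel (G : CGraph C) [Fintype C] :
    G.V × stdSimplex ℝ C → G.V × stdSimplex ℝ C → Prop := fun p q =>
  ∃ c : C, (p.2 : C → ℝ) c = 0 ∧ q.1 = G.edge p.1 c ∧ (q.2 : C → ℝ) = (p.2 : C → ℝ)

instance (G : CGraph C) : TopologicalSpace G.V := ⊥

/-- The topological space `|K(Γ)|` underlying the pseudocomplex associated to `Γ`. -/
abbrev Space (G : CGraph C) [Fintype C] : Type := Quot (glueRel G)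

/-- The connected component ("residue") of the vertex `v` in the subgraph of `G`
obtained by deleting all `c`-colored edges, as a colored graph over the remaining colors. -/
def residue (G : CGraph C) (c : C) (v : G.V) : CGraph {c' : C // c' ≠ c} where
  V := {w : G.V // reaches G {c}ᶜ v w}
  finV := Subtype.finite
  edge := fun w c' =>
    ⟨G.edge w.1 c'.1, w.2.tail ⟨c'.1, Set.mem_compl_singleton_iff.mpr c'.2, rfl⟩⟩
  invol := fun w c' => Subtype.ext (G.invol w.1 c'.1)
  no_loop := fun w c' h => G.no_loop w.1 c'.1 (congrArg Subtype.val h)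

/-- `X` is locally Euclidean of dimension `n`. -/
def IsLocEuclidean (n : ℕ) (X : Type*) [TopologicalSpace X] : Prop :=
  ∀ x : X, ∃ (U : Set X) (W : Set (EuclideanSpace ℝ (Fin n))),
    IsOpen U ∧ IsOpen W ∧ x ∈ U ∧ Nonempty (U ≃ₜ W)

/-- `X` is a closed connected topological `n`-manifold. -/
def IsClosedMfld (n : ℕ) (X : Type*) [TopologicalSpace X] : Prop :=
  CompactSpace X ∧ ConnectedSpace X ∧ IsLocEuclidean n X

/-- `Γ` represents a singular `d`-manifold: for every color `c`, every
`ĉ`-residue of `Γ` represents a closed connected `(d-1)`-manifold. -/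
def IsSingularRep (d : ℕ) (G : CGraph (Fin (d + 1))) : Prop :=
  ∀ (c : Fin (d + 1)) (v : G.V), IsClosedMfld (d - 1) (Space (residue G c v))

/-- The `n`-sphere. -/
abbrev Sph (n : ℕ) : Type := ↥(Metric.sphere (0 : EuclideanSpace ℝ (Fin (n + 1))) 1)

/-- The closed `n`-disk. -/
abbrev Disk (n : ℕ) : Type := ↥(Metric.closedBall (0 : EuclideanSpace ℝ (Fin n)) 1)

/-- `Γ` represents the (singular `d`-manifold) `X`. -/
def Represents (d : ℕ) (G : CGraph (Fin (d + 1))) (X : Type*) [TopologicalSpace X] : Prop :=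
  Connected G ∧ IsSingularRep d G ∧ Nonempty (Space G ≃ₜ X)

/-- The generalized regular genus of the singular manifold `X`:
the infimum of the regular genera of colored graphs representing `X`. -/
noncomputable def sGenus (d : ℕ) (X : Type*) [TopologicalSpace X] : ℝ :=
  sInf {x : ℝ | ∃ (G : CGraph (Fin (d + 1))) (ε : Equiv.Perm (Fin (d + 1))),
    Represents d G X ∧ x = (rhoL G (permList ε) : ℝ)}

/-- The minimal regular genus of the graph `G` over all cyclic permutations. -/
noncomputable def rhoMin (d : ℕ) (G : CGraph (Fin (d + 1))) : ℝ :=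
  sInf {x : ℝ | ∃ ε : Equiv.Perm (Fin (d + 1)), x = (rhoL G (permList ε) : ℝ)}

/-- The Gurau degree of a `(d+1)`-colored graph: the sum of the regular genera over
all `d!/2` cyclic permutations of the colors up to inverse.  (Summing over all
`(d+1)!` permutations counts each such class `2(d+1)` times.) -/
noncomputable def omegaG (d : ℕ) (G : CGraph (Fin (d + 1))) : ℚ :=
  (∑ ε : Equiv.Perm (Fin (d + 1)), rhoL G (permList ε)) / (2 * (d + 1) : ℚ)

/-- The Gurau degree of the singular manifold `X`. -/
noncomputable def sDegree (d : ℕ) (X : Type*) [TopologicalSpace X] : ℝ :=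
  sInf {x : ℝ | ∃ G : CGraph (Fin (d + 1)), Represents d G X ∧ x = (omegaG d G : ℝ)}

/-- The Euler characteristic of the pseudocomplex `K(Γ)`: the `k`-simplices of
`K(Γ)` correspond to the residues of `Γ` over the complements of the
`(k+1)`-element sets of colors. -/
noncomputable def eulerChar (d : ℕ) (G : CGraph (Fin (d + 1))) : ℤ :=
  ∑ B ∈ (Finset.univ : Finset (Fin (d + 1))).powerset.erase Finset.univ,
    (-1 : ℤ) ^ (d - B.card) * gB G ↑B

end Cryst

namespace Cryst

open Topology Filter

/-- On a simply connected base, a `ZMod 2`-torsor described by local trivializations has a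
global section. -/
theorem exists_section_of_simplyConnected {B V : Type*} [TopologicalSpace B]
    [SimplyConnectedSpace B] [LocallyPathConnectedSpace B] (fib : B → Set V)
    (hne : ∀ b, (fib b).Nonempty) (husc : ∀ b, ∀ᶠ b' in 𝓝 b, fib b' ⊆ fib b)
    (f : B → V → ZMod 2)
    (hf : ∀ b b', fib b' ⊆ fib b → ∃ k, ∀ v ∈ fib b', f b' v = f b v + k) :
    ∃ σ : B → ZMod 2, ∀ b, ∀ᶠ b' in 𝓝 b, ∀ v ∈ fib b', f b' v + σ b' = f b v + σ b := by
  choose r hr using hne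
  have key : ∀ i j x, fib x ⊆ fib i → fib x ⊆ fib j → ∀ v ∈ fib x, ∀ w ∈ fib x,
      f i v - f j v = f i w - f j w := by
    intro i j x hi hj v hv w hw
    obtain ⟨k, hk⟩ := hf i x hi
    obtain ⟨l, hl⟩ := hf j x hj
    have h1 := hk v hv
    have h2 := hk w hw
    have h3 := hl v hv
    have h4 := hl w hw
    linear_combination h2 - h1 + h3 - h4
  have hmem : ∀ i x, x ∈ interior {b' | fib b' ⊆ fib i} → fib x ⊆ fib i :=
    fun i x hx => interior_subset (s := {b' | fib b' ⊆ fib i}) hx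
  let Z : FiberBundleCore B B (ZMod 2) :=
    { baseSet := fun i => interior {b' | fib b' ⊆ fib i}
      isOpen_baseSet := fun i => isOpen_interior
      indexAt := id
      mem_baseSet_at := fun x => mem_interior_iff_mem_nhds.2 (husc x)
      coordChange := fun i j x z => z + (f i (r x) - f j (r x))
      coordChange_self := fun i x _ v => by simp
      continuousOn_coordChange := by
        intro i j
        rintro ⟨x, z⟩ ⟨⟨hi, hj⟩, -⟩
        refine (continuous_of_discreteTopology
          (f := fun q : ZMod 2 × ZMod 2 => q.1 + q.2)).continuousAt.comp_continuousWithinAt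
          (f := fun p : B × ZMod 2 => (p.2, f i (r p.1) - f j (r p.1)))
          (continuousWithinAt_snd.prodMk ?_)
        refine ContinuousAt.continuousWithinAt ?_
        refine ContinuousAt.comp (g := fun x => f i (r x) - f j (r x)) (f := Prod.fst) ?_
          continuousAt_fst
        refine (continuousAt_const (y := f i (r x) - f j (r x))).congr ?_
        filter_upwards [husc x] with y hy
        exact key i j x (hmem _ _ hi) (hmem _ _ hj) _ (hr x) _ (hy (hr y))
      coordChange_comp := fun i j k x _ v => by ring }
  have hcov : IsCoveringMap (Bundle.TotalSpace.proj : Z.TotalSpace → B) :=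
    FiberBundle.isCoveringMap
  obtain ⟨b₀⟩ : Nonempty B := inferInstance
  obtain ⟨s, ⟨-, hs⟩, -⟩ := hcov.existsUnique_continuousMap_lifts (ContinuousMap.id B) (a₀ := b₀)
    (e₀ := ⟨b₀, (0 : ZMod 2)⟩) rfl
  have hs' : ∀ b, (s b).proj = b := fun b => congrFun hs b
  let σ : B → ZMod 2 := fun b => (s b).snd
  refine ⟨σ, fun b => ?_⟩
  have hb : (s b) ∈ (Z.localTriv b).source := by
    rw [Z.mem_localTriv_source]
    rw [hs' b]; exact Z.mem_baseSet_at b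
  have hc : ContinuousAt (fun b' => (Z.localTriv b (s b')).2) b :=
    continuousAt_snd.comp (((Z.localTriv b).toOpenPartialHomeomorph.continuousAt hb).comp
      s.continuous.continuousAt)
  have hev := hc.eventually
    ((isOpen_discrete {(Z.localTriv b (s b)).2}).mem_nhds (Set.mem_singleton _))
  filter_upwards [hev, husc b] with b' h1 h2 v hv
  have h3 : ∀ x, (Z.localTriv b (s x)).2 = σ x + (f x (r x) - f b (r x)) := by
    intro x
    rw [Z.localTriv_apply]
    change σ x + (f (s x).proj (r (s x).proj) - f b (r (s x).proj)) = _
    rw [hs']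
  have h4 : (Z.localTriv b (s b')).2 = (Z.localTriv b (s b)).2 := h1
  rw [h3, h3] at h4
  have := key b' b b' subset_rfl h2 v hv _ (hr b')
  linear_combination h4 + this

theorem section_sub_const {B V : Type*} [TopologicalSpace B] (fib : B → Set V)
    (f : B → V → ZMod 2) {D : Set B} (hD : IsPreconnected D) (hne : ∀ b ∈ D, (fib b).Nonempty)
    {σ τ : B → ZMod 2}
    (hσ : ∀ b ∈ D, ∀ᶠ b' in 𝓝 b, ∀ v ∈ fib b', f b' v + σ b' = f b v + σ b)
    (hτ : ∀ b ∈ D, ∀ᶠ b' in 𝓝 b, ∀ v ∈ fib b', f b' v + τ b' = f b v + τ b) {x y : B}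
    (hx : x ∈ D) (hy : y ∈ D) : σ x - τ x = σ y - τ y := by
  refine hD.constant (f := fun b => σ b - τ b) ?_ hx hy
  intro b hb
  refine (continuousWithinAt_const (b := σ b - τ b)).congr_of_eventuallyEq ?_ rfl
  filter_upwards [nhdsWithin_le_nhds (hσ b hb), nhdsWithin_le_nhds (hτ b hb),
    self_mem_nhdsWithin] with b' h1 h2 h3
  obtain ⟨v, hv⟩ := hne b' h3
  linear_combination h1 v hv - h2 v hv

/-- The complement of the closed ray from the origin in the direction `-e`. -/
def slit {E : Type*} [AddCommGroup E] [Module ℝ E] (e : E) : Set E :=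
  {y | ∀ s : ℝ, s ≤ 0 → y ≠ s • e}

section
variable {E : Type*} [NormedAddCommGroup E] [NormedSpace ℝ E]

theorem isOpen_slit (e : E) : IsOpen (slit e) := by
  have : slit e = ((fun s : ℝ => s • e) '' Set.Iic 0)ᶜ := by
    ext y
    simp only [slit, Set.mem_ofPred_eq, Set.mem_compl_iff, Set.mem_image, Set.mem_Iic, not_exists,
      not_and]
    exact ⟨fun h s hs h' => h s hs h'.symm, fun h s hs h' => h s hs h'.symm⟩
  rw [this, isOpen_compl_iff]
  exact isClosedMap_smul_left e _ isClosed_Iic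

theorem mem_slit_self {e : E} (he : e ≠ 0) : e ∈ slit e := by
  intro s hs h
  have : (1 - s) • e = 0 := by rw [sub_smul, one_smul, ← h, sub_self]
  rcases smul_eq_zero.1 this with h | h
  · linarith
  · exact he h

theorem starConvex_slit {e : E} (he : e ≠ 0) : StarConvex ℝ e (slit e) := by
  intro y hy a b ha hb hab s hs h
  rcases hb.eq_or_lt with rfl | hb
  · have : a = 1 := by linarith
    subst this
    refine mem_slit_self he s hs ?_
    simpa using h
  · refine hy ((s - a) / b) (div_nonpos_of_nonpos_of_nonneg (by linarith) hb.le) ?_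
    rw [div_eq_inv_mul, mul_smul, sub_smul, ← h, add_sub_cancel_left, smul_smul,
      inv_mul_cancel₀ hb.ne', one_smul]

theorem slit_union_slit_neg {e : E} (he : e ≠ 0) : slit e ∪ slit (-e) = {0}ᶜ := by
  ext y
  simp only [Set.mem_union, Set.mem_compl_iff, Set.mem_singleton_iff]
  constructor
  · rintro (h | h) rfl
    · exact h 0 le_rfl (by simp)
    · exact h 0 le_rfl (by simp)
  · intro hy
    by_contra! h
    simp only [slit, Set.mem_ofPred_eq, not_forall, not_not] at h
    obtain ⟨⟨s, hs, rfl⟩, t, ht, h⟩ := h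
    have : (s + t) • e = 0 := by rw [add_smul, h]; simp
    rcases smul_eq_zero.1 this with h' | h'
    · have : s = 0 := by linarith
      simp [this] at hy
    · exact he h'

theorem slit_inter_slit_neg (e : E) :
    slit e ∩ slit (-e) = ((ℝ ∙ e : Submodule ℝ E) : Set E)ᶜ := by
  ext y
  simp only [Set.mem_inter_iff, Set.mem_compl_iff, SetLike.mem_coe, Submodule.mem_span_singleton,
    not_exists, slit, Set.mem_ofPred_eq]
  constructor
  · rintro ⟨h1, h2⟩ s rfl
    rcases le_total s 0 with h | h
    · exact h1 s h rfl
    · exact h2 (-s) (by linarith) (by simp)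
  · intro h
    exact ⟨fun s _ h' => h s h'.symm, fun s _ h' => h (-s) (by rw [h']; simp)⟩

theorem exists_section_on_slit {V : Type*} {e : E} (he : e ≠ 0) (fib : E → Set V)
    (hne : ∀ b ∈ slit e, (fib b).Nonempty) (husc : ∀ b ∈ slit e, ∀ᶠ b' in 𝓝 b, fib b' ⊆ fib b)
    (f : E → V → ZMod 2)
    (hf : ∀ b ∈ slit e, ∀ b' ∈ slit e, fib b' ⊆ fib b → ∃ k, ∀ v ∈ fib b', f b' v = f b v + k) :
    ∃ σ : E → ZMod 2, ∀ b ∈ slit e, ∀ᶠ b' in 𝓝 b, ∀ v ∈ fib b', f b' v + σ b' = f b v + σ b := by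
  have : ContractibleSpace (slit e) := (starConvex_slit he).contractibleSpace ⟨e, mem_slit_self he⟩
  have : LocallyPathConnectedSpace (slit e) := (isOpen_slit e).locallyPathConnectedSpace
  obtain ⟨σ, hσ⟩ := exists_section_of_simplyConnected (B := slit e) (fun b => fib b)
    (fun b => hne b b.2) (fun b => continuous_subtype_val.continuousAt.eventually (husc b b.2))
    (fun b => f b) (fun b b' => hf b b.2 b' b'.2)
  refine ⟨fun y => if h : y ∈ slit e then σ ⟨y, h⟩ else 0, fun b hb => ?_⟩
  have h1 := hσ ⟨b, hb⟩
  rw [nhds_subtype_eq_comap, eventually_comap] at h1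
  filter_upwards [h1, (isOpen_slit e).mem_nhds hb] with b' h2 h3
  have := h2 ⟨b', h3⟩ rfl
  simpa [h3, hb] using this

/-- A `ZMod 2`-torsor over a punctured space of dimension at least three has a section. -/
theorem exists_section_punctured {V : Type*} (hE : 2 < Module.finrank ℝ E) (fib : E → Set V)
    (hne : ∀ b, b ≠ 0 → (fib b).Nonempty) (husc : ∀ b, b ≠ 0 → ∀ᶠ b' in 𝓝 b, fib b' ⊆ fib b)
    (f : E → V → ZMod 2)
    (hf : ∀ b, b ≠ 0 → ∀ b', b' ≠ 0 → fib b' ⊆ fib b → ∃ k, ∀ v ∈ fib b', f b' v = f b v + k) :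
    ∃ σ : E → ZMod 2, ∀ b, b ≠ 0 → ∀ᶠ b' in 𝓝 b, ∀ v ∈ fib b', f b' v + σ b' = f b v + σ b := by
  have : FiniteDimensional ℝ E := FiniteDimensional.of_finrank_pos (by omega)
  have : Nontrivial E := Module.nontrivial_of_finrank_pos (R := ℝ) (by omega)
  obtain ⟨e, he⟩ := exists_ne (0 : E)
  have hu := slit_union_slit_neg he
  have hp : ∀ y ∈ slit e, y ≠ 0 := fun y hy => (hu ▸ Or.inl hy : y ∈ ({0}ᶜ : Set E))
  have hn : ∀ y ∈ slit (-e), y ≠ 0 := fun y hy => (hu ▸ Or.inr hy : y ∈ ({0}ᶜ : Set E))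
  obtain ⟨σ, hσ⟩ := exists_section_on_slit he fib (fun b hb => hne b (hp b hb))
    (fun b hb => husc b (hp b hb)) f (fun b hb b' hb' => hf b (hp b hb) b' (hp b' hb'))
  obtain ⟨τ, hτ⟩ := exists_section_on_slit (neg_ne_zero.2 he) fib (fun b hb => hne b (hn b hb))
    (fun b hb => husc b (hn b hb)) f (fun b hb b' hb' => hf b (hn b hb) b' (hn b' hb'))
  have hconn : IsConnected (slit e ∩ slit (-e)) := by
    rw [slit_inter_slit_neg]
    refine isConnected_compl_of_one_lt_codim ?_
    rw [← Module.finrank_eq_rank]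
    have h1 := Submodule.finrank_quotient_add_finrank (ℝ ∙ e)
    rw [finrank_span_singleton he] at h1
    exact_mod_cast (by omega : 1 < Module.finrank ℝ (E ⧸ (ℝ ∙ e)))
  obtain ⟨x, hx⟩ := hconn.nonempty
  have hdiff : ∀ y ∈ slit e ∩ slit (-e), σ y = τ y + (σ x - τ x) := by
    intro y hy
    have := section_sub_const fib f hconn.isPreconnected (fun b hb => hne b (hp b hb.1))
      (fun b hb => hσ b hb.1) (fun b hb => hτ b hb.2) hx hy
    linear_combination -this
  have hneg : ∀ y ∈ slit (-e),
      (if y ∈ slit e then σ y else τ y + (σ x - τ x)) = τ y + (σ x - τ x) := by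
    intro y hy
    split_ifs with h
    · exact hdiff y ⟨h, hy⟩
    · rfl
  refine ⟨fun y => if y ∈ slit e then σ y else τ y + (σ x - τ x), fun b hb => ?_⟩
  have hb' : b ∈ slit e ∪ slit (-e) := hu ▸ hb
  rcases hb' with h | h
  · filter_upwards [hσ b h, (isOpen_slit e).mem_nhds h] with b' h1 h2
    simpa [h, h2] using h1
  · filter_upwards [hτ b h, (isOpen_slit (-e)).mem_nhds h] with b' h1 h2 v hv
    simp only [hneg b h, hneg b' h2]
    linear_combination h1 v hv

end
end Cryst

namespace Cryst

open Topology Filter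

theorem step_symm {C : Type} {G : CGraph C} {B : Set C} {v w : G.V} (h : step G B v w) :
    step G B w v := by
  obtain ⟨c, hc, rfl⟩ := h
  exact ⟨c, hc, G.invol v c⟩

theorem reaches_symm {C : Type} {G : CGraph C} {B : Set C} {v w : G.V} (h : reaches G B v w) :
    reaches G B w v :=
  have : Std.Symm (step G B) := ⟨fun _ _ => step_symm⟩
  symm_of (Relation.ReflTransGen (step G B)) h

theorem reaches_mono {C : Type} {G : CGraph C} {B B' : Set C} (hB : B ⊆ B') {v w : G.V}
    (h : reaches G B v w) : reaches G B' v w :=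
  Relation.ReflTransGen.mono (fun _ _ ⟨c, hc, h⟩ => ⟨c, hB hc, h⟩) _ _ h

/-- `h` is a primitive of the edge function `a` along the edges colored by `B`. -/
def IsPrimitive {C : Type} (G : CGraph C) (B : Set C) (a : G.V → C → ZMod 2)
    (h : G.V → ZMod 2) : Prop :=
  ∀ v, ∀ c ∈ B, h (G.edge v c) = h v + a v c

theorem IsPrimitive.sub_eq {C : Type} {G : CGraph C} {B : Set C} {a : G.V → C → ZMod 2}
    {h h' : G.V → ZMod 2} (hh : IsPrimitive G B a h) (hh' : IsPrimitive G B a h') {v w : G.V}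
    (hvw : reaches G B v w) : h w - h' w = h v - h' v := by
  induction hvw with
  | refl => rfl
  | tail _ hs ih =>
    obtain ⟨c, hc, rfl⟩ := hs
    rw [← ih, hh _ c hc, hh' _ c hc]
    ring

section Geometry
variable {C : Type} [Fintype C] (G : CGraph C)

/-- The set of colors at which a point of the simplex vanishes. -/
def zeros {C : Type} [Fintype C] (t : stdSimplex ℝ C) : Set C := {c | t c = 0}

/-- The point of `|K(Γ)|` with coordinates `t` in the simplex labelled `v`. -/
def pt (v : G.V) (t : stdSimplex ℝ C) : Space G := Quot.mk _ (v, t)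

/-- The barycentric coordinates of a point of `|K(Γ)|`. -/
def coord : Space G → stdSimplex ℝ C :=
  Quot.lift Prod.snd (fun _ _ ⟨_, _, _, h⟩ => (Subtype.ext h).symm)

@[simp]
theorem coord_pt (v : G.V) (t : stdSimplex ℝ C) : coord G (pt G v t) = t := rfl

theorem pt_eq_of_reaches {v w : G.V} {t : stdSimplex ℝ C} (h : reaches G (zeros t) v w) :
    pt G v t = pt G w t := by
  induction h with
  | refl => rfl
  | tail _ hs ih =>
    obtain ⟨c, hc, rfl⟩ := hs
    exact ih.trans (Quot.sound ⟨c, hc, rfl, rfl⟩)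

theorem reaches_of_pt_eq {v w : G.V} {t : stdSimplex ℝ C} (h : pt G v t = pt G w t) :
    reaches G (zeros t) v w := by
  have key : ∀ p q : G.V × stdSimplex ℝ C, Relation.EqvGen (glueRel G) p q →
      p.2 = q.2 ∧ reaches G (zeros p.2) p.1 q.1 := by
    intro p q h
    induction h with
    | rel p q h =>
      obtain ⟨c, hc, h1, h2⟩ := h
      exact ⟨(Subtype.ext h2).symm, .single ⟨c, hc, h1.symm⟩⟩
    | refl p => exact ⟨rfl, .refl⟩
    | symm p q _ ih => exact ⟨ih.1.symm, ih.1 ▸ reaches_symm ih.2⟩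
    | trans p q r _ _ ih1 ih2 => exact ⟨ih1.1.trans ih2.1, ih1.2.trans (ih1.1 ▸ ih2.2)⟩
  exact (key _ _ (Quot.eqvGen_exact h)).2

theorem pt_coord_surj (x : Space G) : ∃ v, pt G v (coord G x) = x := by
  obtain ⟨⟨v, t⟩, rfl⟩ := Quot.exists_rep x
  exact ⟨v, rfl⟩

instance : DiscreteTopology G.V := ⟨rfl⟩

theorem continuous_pt (v : G.V) : Continuous (pt G v) :=
  continuous_quot_mk.comp (Continuous.prodMk_right v)

theorem continuous_coord : Continuous (coord G) := continuous_quot_lift _ continuous_snd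

theorem isOpen_iff_pt {A : Set (Space G)} : IsOpen A ↔ ∀ v, IsOpen (pt G v ⁻¹' A) := by
  refine ⟨fun h v => h.preimage (continuous_pt G v), fun h => ?_⟩
  rw [← isQuotientMap_quot_mk.isOpen_preimage, isOpen_iff_mem_nhds]
  rintro ⟨v, t⟩ ht
  rw [nhds_prod_eq, nhds_discrete, pure_prod]
  exact (h v).mem_nhds ht

theorem continuous_stdSimplex_apply (c : C) :
    Continuous (fun t : stdSimplex ℝ C => t c) :=
  (continuous_apply c).comp continuous_subtype_val

theorem eventually_zeros_subset (t : stdSimplex ℝ C) : ∀ᶠ s in 𝓝 t, zeros s ⊆ zeros t := by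
  have : ∀ c, ∀ᶠ s in 𝓝 t, c ∈ zeros s → c ∈ zeros t := by
    intro c
    by_cases hc : c ∈ zeros t
    · exact Eventually.of_forall fun _ _ => hc
    · filter_upwards [(continuous_stdSimplex_apply c).continuousAt.eventually_ne hc] with s hs hs'
      exact absurd hs' hs
  filter_upwards [eventually_all.2 this] with s hs c hc using hs c hc

theorem eventually_pt_coord (x : Space G) :
    ∀ᶠ y in 𝓝 x, ∀ v, pt G v (coord G y) = y → pt G v (coord G x) = x := by
  have hopen : IsOpen {y : Space G | ∀ v, pt G v (coord G y) = y → pt G v (coord G x) = x} := by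
    rw [isOpen_iff_pt]
    intro w
    rw [isOpen_iff_mem_nhds]
    intro t ht
    filter_upwards [eventually_zeros_subset t] with s hs v hv
    refine ht v ?_
    exact pt_eq_of_reaches G (reaches_mono hs (reaches_of_pt_eq G hv))
  exact hopen.mem_nhds fun v hv => hv

/-- The open star of the vertex of `|K(Γ)|` corresponding to the residue of `v₀` missing `c`. -/
def openStar (c : C) (v₀ : G.V) : Set (Space G) :=
  {x | 0 < coord G x c ∧ ∀ v, pt G v (coord G x) = x → reaches G {c}ᶜ v₀ v}

theorem isOpen_openStar (c : C) (v₀ : G.V) : IsOpen (openStar G c v₀) := by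
  rw [isOpen_iff_mem_nhds]
  rintro x ⟨h1, h2⟩
  filter_upwards [eventually_pt_coord G x, ((continuous_stdSimplex_apply c).comp
    (continuous_coord G)).continuousAt.eventually (lt_mem_nhds h1)] with y hy1 hy2
  exact ⟨hy2, fun v hv => h2 v (hy1 v hv)⟩

theorem pt_mem_openStar {c : C} {v₀ v : G.V} (hv : reaches G {c}ᶜ v₀ v) {t : stdSimplex ℝ C}
    (ht : 0 < t c) : pt G v t ∈ openStar G c v₀ := by
  refine ⟨ht, fun w hw => hv.trans (reaches_symm (reaches_mono ?_ (reaches_of_pt_eq G hw)))⟩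
  rintro k hk rfl
  exact ht.ne' hk

/-- The vertex of the simplex labelled `c`. -/
noncomputable def corner (c : C) : stdSimplex ℝ C := stdSimplex.vertex c

theorem corner_apply (c k : C) : corner c k = (Pi.single c 1 : C → ℝ) k := rfl

theorem zeros_corner (c : C) : zeros (corner c) = {c}ᶜ := by
  ext k
  simp [zeros, corner_apply, Pi.single_apply]

theorem eq_corner {c : C} {t : stdSimplex ℝ C} (h : {c}ᶜ ⊆ zeros t) : t = corner c := by
  have h0 : ∀ k, k ≠ c → t k = 0 := fun k hk => h hk
  ext k
  by_cases hk : k = c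
  · subst hk
    have := stdSimplex.sum_eq_one t
    rw [Finset.sum_eq_single k (fun j _ hj => h0 j hj) (by simp)] at this
    simpa [corner_apply] using this
  · simp [corner_apply, hk, h0 k hk]

theorem zeros_ssubset_of_mem_openStar {c : C} {v₀ : G.V} {x : Space G}
    (hx : x ∈ openStar G c v₀) (hne : x ≠ pt G v₀ (corner c)) :
    zeros (coord G x) ⊂ {c}ᶜ := by
  refine ⟨fun k hk hkc => hx.1.ne' (by rw [← Set.mem_singleton_iff.1 hkc]; exact hk), fun h => hne ?_⟩
  have ht := eq_corner h
  obtain ⟨v, hv⟩ := pt_coord_surj G x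
  rw [← hv, ht]
  refine (pt_eq_of_reaches G ?_).symm
  rw [zeros_corner]
  exact hx.2 v hv

theorem IsLocEuclidean.exists_chart {n : ℕ} {X : Type*} [TopologicalSpace X]
    (h : IsLocEuclidean n X) {O : Set X} (hO : IsOpen O) {x : X} (hx : x ∈ O) :
    ∃ e : EuclideanSpace ℝ (Fin n) → X, IsOpenEmbedding e ∧ e 0 = x ∧ Set.range e ⊆ O := by
  obtain ⟨U, W, hU, hW, hxU, ⟨ψ⟩⟩ := h x
  have hj : IsOpenEmbedding (Subtype.val ∘ ψ.symm : W → X) :=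
    hU.isOpenEmbedding_subtypeVal.comp ψ.symm.isOpenEmbedding
  have hW' : IsOpen (Subtype.val '' ((Subtype.val ∘ ψ.symm : W → X) ⁻¹' O)) :=
    hW.isOpenEmbedding_subtypeVal.isOpenMap _ (hO.preimage hj.continuous)
  obtain ⟨r, hr, hball⟩ := Metric.isOpen_iff.1 hW' (ψ ⟨x, hxU⟩)
    ⟨ψ ⟨x, hxU⟩, by simpa using hx, rfl⟩
  let u := OpenPartialHomeomorph.univBall (ψ ⟨x, hxU⟩ : EuclideanSpace ℝ (Fin n)) r
  have hu : IsOpenEmbedding u :=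
    u.isOpenEmbedding (OpenPartialHomeomorph.univBall_source _ _)
  have hmem : ∀ y, u y ∈ Metric.ball (ψ ⟨x, hxU⟩ : EuclideanSpace ℝ (Fin n)) r := by
    intro y
    rw [← OpenPartialHomeomorph.univBall_target _ hr]
    exact u.map_source (by rw [OpenPartialHomeomorph.univBall_source]; trivial)
  have huW : ∀ y, u y ∈ W := by
    intro y
    obtain ⟨w, -, hw⟩ := hball (hmem y)
    exact hw ▸ w.2
  have hu' : IsOpenEmbedding (fun y => (⟨u y, huW y⟩ : W)) :=
    IsOpenEmbedding.of_comp _ hW.isOpenEmbedding_subtypeVal hu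
  refine ⟨_, hj.comp hu', ?_, ?_⟩
  · have h0 : (⟨u 0, huW 0⟩ : W) = ψ ⟨x, hxU⟩ :=
      Subtype.ext (OpenPartialHomeomorph.univBall_apply_zero _ _)
    simp [h0]
  · rintro _ ⟨y, rfl⟩
    obtain ⟨w, hw1, hw2⟩ := hball (hmem y)
    have : (⟨u y, huW y⟩ : W) = w := Subtype.ext hw2.symm
    simpa [this] using hw1

theorem isPreconnected_slice (c : C) (r : ℝ) :
    IsPreconnected {t : stdSimplex ℝ C | t c = r} := by
  rw [← IsInducing.subtypeVal.isPreconnected_image]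
  refine Convex.isPreconnected ?_
  rintro _ ⟨t, ht, rfl⟩ _ ⟨s, hs, rfl⟩ α β hα hβ hαβ
  refine ⟨⟨_, convex_stdSimplex ℝ C t.2 s.2 hα hβ hαβ⟩, ?_, rfl⟩
  simp only [Set.mem_ofPred_eq] at ht hs
  change α * t c + β * s c = r
  rw [ht, hs, ← add_mul, hαβ, one_mul]

theorem exists_slice_subset {c : C} (A : G.V → Set (stdSimplex ℝ C)) (hA : ∀ v, A v ∈ 𝓝 (corner c)) :
    ∃ r : ℝ, 0 < r ∧ r < 1 ∧ ∀ v, ∀ t : stdSimplex ℝ C, t c = r → t ∈ A v := by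
  have hall : ∀ᶠ t in 𝓝 (corner c), ∀ v, t ∈ A v := eventually_all.2 hA
  obtain ⟨ε, hε, hball⟩ := Metric.eventually_nhds_iff.1 hall
  have hm : 0 < min ε 1 := lt_min hε one_pos
  refine ⟨1 - min ε 1 / 2, by linarith [min_le_right ε 1], by linarith,
    fun v t ht => hball ?_ v⟩
  rw [Subtype.dist_eq]
  refine lt_of_le_of_lt ((dist_pi_le_iff (by positivity : 0 ≤ min ε 1 / 2)).2 fun k =>
    (?_ : dist (t k) (corner c k) ≤ _))
    (by linarith [min_le_left ε 1] : min ε 1 / 2 < ε)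
  by_cases hk : k = c
  · subst hk
    rw [ht, Real.dist_eq, abs_le]
    simp only [corner_apply, Pi.single_eq_same]
    constructor <;> linarith
  · have h1 := stdSimplex.sum_eq_one t
    rw [← Finset.add_sum_erase _ _ (Finset.mem_univ c), ht] at h1
    have h2 : t k ≤ ∑ j ∈ Finset.univ.erase c, t j :=
      Finset.single_le_sum (fun j _ => stdSimplex.zero_le t j) (by simp [hk])
    have h3 := stdSimplex.zero_le t k
    rw [Real.dist_eq, abs_le]
    simp only [corner_apply, Pi.single_apply, hk, if_false]
    constructor <;> linarith

theorem exists_slice_point {c i j : C} (hi : i ≠ c) (hj : j ≠ c) (hij : j ≠ i) {r : ℝ}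
    (h0 : 0 < r) (h1 : r < 1) :
    ∃ t : stdSimplex ℝ C, t c = r ∧ t i = 0 := by
  refine ⟨⟨_, convex_stdSimplex ℝ C (single_mem_stdSimplex ℝ c) (single_mem_stdSimplex ℝ j)
    h0.le (sub_nonneg.2 h1.le) (by ring)⟩, ?_, ?_⟩
  · change r * (Pi.single c 1 : C → ℝ) c + (1 - r) * (Pi.single j 1 : C → ℝ) c = r
    simp [hj.symm]
  · change r * (Pi.single c 1 : C → ℝ) i + (1 - r) * (Pi.single j 1 : C → ℝ) i = 0
    simp [hi, hij.symm]

/-- If `|K(Γ)|` is locally Euclidean of dimension at least three, then an edge function which has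
primitives on all smaller residues has a primitive on each residue missing a color. -/
theorem exists_primitive_of_isLocEuclidean {n : ℕ} (hn : 2 < n)
    (hG : IsLocEuclidean n (Space G)) {c : C} (hC : ∀ i, i ≠ c → ∃ j, j ≠ c ∧ j ≠ i) (v₀ : G.V)
    (a : G.V → C → ZMod 2)
    (ha : ∀ Z : Set C, Z ⊂ {c}ᶜ → ∃ h, IsPrimitive G Z a h) :
    ∃ f : G.V → ZMod 2, ∀ v, reaches G {c}ᶜ v₀ v → ∀ i, i ≠ c →
      f (G.edge v i) = f v + a v i := by
  have hcorner : ∀ v, reaches G {c}ᶜ v₀ v → pt G v (corner c) = pt G v₀ (corner c) :=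
    fun v hv => (pt_eq_of_reaches G (by rwa [zeros_corner])).symm
  obtain ⟨e, he, he0, heO⟩ := hG.exists_chart (isOpen_openStar G c v₀)
    (pt_mem_openStar G (t := corner c) .refl (by simp [corner_apply]))
  have hss : ∀ y, y ≠ 0 → zeros (coord G (e y)) ⊂ {c}ᶜ := fun y hy =>
    zeros_ssubset_of_mem_openStar G (heO ⟨y, rfl⟩) fun h => hy (he.injective (h.trans he0.symm))
  choose! p hp using ha
  let fib : EuclideanSpace ℝ (Fin n) → Set (G.V × Set C) := fun y =>
    {q | pt G q.1 (coord G (e y)) = e y ∧ q.2 ⊆ zeros (coord G (e y))}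
  have husc : ∀ y, ∀ᶠ y' in 𝓝 y, fib y' ⊆ fib y := by
    intro y
    filter_upwards [he.continuous.continuousAt.eventually (eventually_pt_coord G (e y)),
      ((continuous_coord G).comp he.continuous).continuousAt.eventually
        (eventually_zeros_subset _)] with y' h1 h2 q hq
    exact ⟨h1 _ hq.1, hq.2.trans h2⟩
  obtain ⟨σ, hσ⟩ := exists_section_punctured (E := EuclideanSpace ℝ (Fin n)) (by simpa) fib
    (fun y _ => by
      obtain ⟨v, hv⟩ := pt_coord_surj G (e y)
      exact ⟨(v, ∅), hv, Set.empty_subset _⟩)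
    (fun y _ => husc y) (fun y q => p (zeros (coord G (e y))) q.1) (by
      intro y hy y' hy' hsub
      obtain ⟨v, hv⟩ := pt_coord_surj G (e y')
      have hZ : zeros (coord G (e y')) ⊆ zeros (coord G (e y)) :=
        (hsub (show (v, zeros (coord G (e y'))) ∈ fib y' from ⟨hv, subset_rfl⟩)).2
      refine ⟨p (zeros (coord G (e y'))) v - p (zeros (coord G (e y))) v, fun q hq => ?_⟩
      have := (hp _ (hss y' hy')).sub_eq (fun w k hk => hp _ (hss y hy) w k (hZ hk))
        (reaches_of_pt_eq G (hv.trans hq.1.symm))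
      linear_combination this)
  let g : EuclideanSpace ℝ (Fin n) → G.V → ZMod 2 := fun y v =>
    p (zeros (coord G (e y))) v + σ y
  have hg : ∀ y, y ≠ 0 → ∀ᶠ y' in 𝓝 y, ∀ v, pt G v (coord G (e y')) = e y' → g y' v = g y v :=
    fun y hy => (hσ y hy).mono fun y' h v hv => h (v, ∅) ⟨hv, Set.empty_subset _⟩
  obtain ⟨r, hr0, hr1, hr⟩ := exists_slice_subset G (c := c)
    (fun v => {t | reaches G {c}ᶜ v₀ v → pt G v t ∈ Set.range e}) (by
      intro v
      by_cases hv : reaches G {c}ᶜ v₀ v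
      · filter_upwards [(continuous_pt G v).continuousAt.eventually (he.isOpen_range.mem_nhds
          ⟨0, by rw [he0, hcorner v hv]⟩)] with t ht _ using ht
      · exact Eventually.of_forall fun t h => absurd h hv)
  choose! Y hY using hr
  have hY0 : ∀ v (t : stdSimplex ℝ C), t c = r → reaches G {c}ᶜ v₀ v → Y v t ≠ 0 := by
    intro v t ht hv h0
    have h1 := congrArg (coord G) (hY v t ht hv)
    rw [h0, he0, coord_pt, coord_pt] at h1
    rw [← h1] at ht
    rw [corner_apply, Pi.single_eq_same] at ht
    exact hr1.ne' ht
  have hconst : ∀ v, reaches G {c}ᶜ v₀ v → ∀ t s : stdSimplex ℝ C, t c = r →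
      s c = r → g (Y v t) v = g (Y v s) v := by
    intro v hv t s ht hs
    refine (isPreconnected_slice c r).constant (f := fun t => g (Y v t) v) ?_ ht hs
    intro t ht
    refine (continuousWithinAt_const (b := g (Y v t) v)).congr_of_eventuallyEq ?_ rfl
    have hcont : Tendsto (Y v) (𝓝[{t : stdSimplex ℝ C | t c = r}] t) (𝓝 (Y v t)) := by
      rw [he.isInducing.nhds_eq_comap, tendsto_comap_iff, hY v t ht hv]
      refine ((continuous_pt G v).continuousWithinAt (x := t)).congr' ?_
      filter_upwards [self_mem_nhdsWithin] with s hs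
      exact (hY v s hs hv).symm
    filter_upwards [hcont.eventually (hg _ (hY0 v t ht hv)), self_mem_nhdsWithin] with s h1 h2
    refine h1 v ?_
    rw [hY v s h2 hv, coord_pt]
  have hslice : ∀ i, i ≠ c → ∃ t : stdSimplex ℝ C, t c = r ∧ t i = 0 := by
    intro i hi
    obtain ⟨j, hj, hij⟩ := hC i hi
    exact exists_slice_point hi hj hij hr0 hr1
  by_cases htriv : ∃ i, i ≠ c
  · obtain ⟨i₀, hi₀⟩ := htriv
    obtain ⟨t₀, ht₀, -⟩ := hslice i₀ hi₀
    refine ⟨fun v => g (Y v t₀) v, fun v hv i hi => ?_⟩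
    have hv' : reaches G {c}ᶜ v₀ (G.edge v i) := hv.tail ⟨i, hi, rfl⟩
    obtain ⟨t, ht, hti⟩ := hslice i hi
    have hpt : pt G v t = pt G (G.edge v i) t := pt_eq_of_reaches G (.single ⟨i, hti, rfl⟩)
    have hYY : Y (G.edge v i) t = Y v t :=
      he.injective (by rw [hY _ t ht hv', hY v t ht hv, hpt])
    have hcoord : coord G (e (Y v t)) = t := by rw [hY v t ht hv, coord_pt]
    simp only
    rw [hconst _ hv' t₀ t ht₀ ht, hconst v hv t₀ t ht₀ ht, hYY]
    have := hp _ (hss _ (hY0 v t ht hv)) v i (by rw [hcoord]; exact hti)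
    simp only [g]
    rw [this]
    ring
  · exact ⟨0, fun v _ i hi => absurd ⟨i, hi⟩ htriv⟩

end Geometry
end Cryst

namespace Cryst

theorem quot_mk_eq_iff {C : Type} {G : CGraph C} {B : Set C} {v w : G.V} :
    Quot.mk (step G B) v = Quot.mk (step G B) w ↔ reaches G B v w := by
  constructor
  · intro h
    have h' := Quot.eqvGen_exact h
    clear h
    induction h' with
    | rel _ _ h => exact .single h
    | refl _ => exact .refl
    | symm _ _ _ ih => exact reaches_symm ih
    | trans _ _ _ _ _ ih1 ih2 => exact ih1.trans ih2
  · intro h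
    induction h with
    | refl => rfl
    | tail _ hs ih => exact ih.trans (Quot.sound hs)

theorem reaches_residue {C : Type} {G : CGraph C} {d : C} {v : G.V} {B : Set {c' : C // c' ≠ d}}
    (w : (residue G d v).V) {x : G.V} (h : reaches G (Subtype.val '' B) w.1 x) :
    ∃ hx, reaches (residue G d v) B w ⟨x, hx⟩ := by
  induction h with
  | refl => exact ⟨w.2, .refl⟩
  | tail _ hs ih =>
    obtain ⟨hy, ih⟩ := ih
    obtain ⟨_, ⟨c, hc, rfl⟩, rfl⟩ := hs
    exact ⟨((residue G d v).edge ⟨_, hy⟩ c).2, ih.tail ⟨c, hc, rfl⟩⟩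

/-- Local primitives, one on each component, glue to a global one. -/
theorem exists_isPrimitive_of_forall_component {C : Type} {G : CGraph C} {B : Set C}
    {a : G.V → C → ZMod 2}
    (h : ∀ u, ∃ f : G.V → ZMod 2, ∀ v, reaches G B u v → ∀ i ∈ B, f (G.edge v i) = f v + a v i) :
    ∃ f, IsPrimitive G B a f := by
  choose F hF using h
  let r : G.V → G.V := fun v => (Quot.mk (step G B) v).out
  have hr : ∀ v, reaches G B (r v) v := fun v => quot_mk_eq_iff.1 (Quot.out_eq _)
  refine ⟨fun v => F (r v) v, fun v i hi => ?_⟩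
  have hrr : r (G.edge v i) = r v :=
    congrArg Quot.out (quot_mk_eq_iff.2 (.single ⟨i, hi, G.invol v i⟩))
  simp only [hrr]
  exact hF _ v (hr v) i hi

theorem IsSingularRep.exists_isPrimitive {G : CGraph (Fin 5)} (hG : IsSingularRep 4 G)
    {c d : Fin 5} (hcd : c ≠ d) {a : G.V → Fin 5 → ZMod 2}
    (ha : ∀ Z : Set (Fin 5), Z ⊂ {c, d}ᶜ → ∃ h, IsPrimitive G Z a h) :
    ∃ f, IsPrimitive G {c, d}ᶜ a f := by
  refine exists_isPrimitive_of_forall_component fun u => ?_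
  have hcol : ∀ c d i : Fin 5, c ≠ d → i ≠ d → i ≠ c → ∃ j, j ≠ d ∧ j ≠ c ∧ j ≠ i := by decide
  have himage : Subtype.val '' ({⟨c, hcd⟩}ᶜ : Set {c' : Fin 5 // c' ≠ d}) = {c, d}ᶜ := by
    ext i
    simp [Subtype.ext_iff]
  let R := residue G d u
  obtain ⟨f, hf⟩ := exists_primitive_of_isLocEuclidean R (n := 3) (by norm_num) (hG d u).2.2
    (c := ⟨c, hcd⟩)
    (fun i hi => by
      obtain ⟨j, hj, hj', hj''⟩ := hcol c d i hcd i.2 (fun h => hi (Subtype.ext h))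
      exact ⟨⟨j, hj⟩, fun h => hj' (congrArg Subtype.val h), fun h => hj'' (congrArg Subtype.val h)⟩)
    ⟨u, .refl⟩ (fun w i => a w.1 i.1) (fun Z hZ => by
      obtain ⟨h, hh⟩ := ha (Subtype.val '' Z)
        (himage ▸ Subtype.val_injective.image_strictMono hZ)
      exact ⟨fun w => h w.1, fun w i hi => hh w.1 i.1 ⟨i, hi, rfl⟩⟩)
  let φ : G.V → ZMod 2 := fun v => if hv : reaches G {d}ᶜ u v then f ⟨v, hv⟩ else 0
  have hφ : ∀ v hv, φ v = f ⟨v, hv⟩ := fun v hv => dif_pos hv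
  refine ⟨φ, fun v hv i hi => ?_⟩
  rw [← himage] at hv
  obtain ⟨hx, hv'⟩ := reaches_residue (v := u) ⟨u, .refl⟩ hv
  have hid : i ≠ d := fun h => hi (by simp [h])
  have hic : i ≠ c := fun h => hi (by simp [h])
  have := hf _ hv' ⟨i, hid⟩ (fun h => hic (congrArg Subtype.val h))
  have hy : reaches G {d}ᶜ u (G.edge v i) := hx.tail ⟨i, hid, rfl⟩
  rw [hφ _ hx, hφ _ hy]
  exact this

end Cryst

namespace Cryst

section Invariants
variable {C : Type} (G : CGraph C)

/-- The functions on the vertices that are constant along the edges colored by `B`. -/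
def invariants (B : Set C) : Submodule (ZMod 2) (G.V → ZMod 2) where
  carrier := {f | ∀ v, ∀ c ∈ B, f (G.edge v c) = f v}
  add_mem' hf hg v c hc := by simp [hf v c hc, hg v c hc]
  zero_mem' _ _ _ := rfl
  smul_mem' k f hf v c hc := by simp [hf v c hc]

theorem mem_invariants {B : Set C} {f : G.V → ZMod 2} :
    f ∈ invariants G B ↔ ∀ v, ∀ c ∈ B, f (G.edge v c) = f v := Iff.rfl

theorem invariants_union (B B' : Set C) :
    invariants G (B ∪ B') = invariants G B ⊓ invariants G B' := by
  ext f
  simp only [Submodule.mem_inf, mem_invariants, Set.mem_union]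
  grind

theorem finrank_invariants (B : Set C) :
    Module.finrank (ZMod 2) (invariants G B) = gB G B := by
  have e : (Quot (step G B) → ZMod 2) ≃ₗ[ZMod 2] invariants G B :=
    { toFun := fun φ => ⟨fun v => φ (Quot.mk _ v), fun v c hc =>
        congrArg φ (Quot.sound ⟨c, hc, G.invol v c⟩)⟩
      map_add' := fun _ _ => rfl
      map_smul' := fun _ _ => rfl
      invFun := fun f => Quot.lift f.1 (fun v w ⟨c, hc, h⟩ => h ▸ (f.2 v c hc).symm)
      left_inv := fun φ => by ext q; induction q using Quot.ind; rfl
      right_inv := fun f => rfl }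
  have := Fintype.ofFinite (Quot (step G B))
  rw [← e.finrank_eq, Module.finrank_fintype_fun_eq_card, gB, Nat.card_eq_fintype_card]

theorem gB_empty : gB G ∅ = Nat.card G.V := by
  have := Fintype.ofFinite G.V
  have h : invariants G ∅ = ⊤ := by
    ext f
    simp [mem_invariants]
  rw [← finrank_invariants, h, finrank_top, Module.finrank_fintype_fun_eq_card,
    Nat.card_eq_fintype_card]

theorem gB_univ (hc : Connected G) : gB G Set.univ = 1 := by
  obtain ⟨⟨v⟩, hr⟩ := hc
  refine Nat.card_eq_one_iff_exists.2 ⟨Quot.mk _ v, fun q => ?_⟩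
  induction q using Quot.ind with
  | mk w => exact quot_mk_eq_iff.2 (hr w v)

theorem sum_mul_eq_zero [Fintype G.V] {c : C} {f g : G.V → ZMod 2} (hf : f ∈ invariants G {c})
    (hg : g ∈ invariants G {c}) : ∑ v, f v * g v = 0 := by
  refine Finset.sum_involution (fun v _ => G.edge v c) (fun v _ => ?_) (fun v _ _ => G.no_loop v c)
    (fun _ _ => Finset.mem_univ _) (fun v _ => G.invol v c)
  rw [hf v c rfl, hg v c rfl]
  exact CharTwo.add_self_eq_zero _

theorem finrank_iSup_invariants (B : Set C) :
    Module.finrank (ZMod 2) (⨆ c ∈ B, invariants G {c} : Submodule _ _) + gB G B =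
      Nat.card G.V := by
  have := Fintype.ofFinite G.V
  let D : LinearMap.BilinForm (ZMod 2) (G.V → ZMod 2) := dotProductBilin (ZMod 2) (ZMod 2)
  have hD : LinearMap.ker D = ⊥ :=
    LinearMap.ker_eq_bot'.2 fun f hf => dotProduct_eq_zero f fun g => LinearMap.congr_fun hf g
  have hperp : D.orthogonal (⨆ c ∈ B, invariants G {c}) = invariants G B := by
    ext f
    rw [LinearMap.BilinForm.mem_orthogonal_iff]
    constructor
    · intro h v c hc
      have h1 : Pi.single v 1 + Pi.single (G.edge v c) 1 ∈ invariants G {c} := by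
        intro w c' hc'
        obtain rfl : c' = c := hc'
        have h2 : G.edge w c' = v ↔ w = G.edge v c' :=
          ⟨fun h => by rw [← h, G.invol], fun h => by rw [h, G.invol]⟩
        have h3 : G.edge w c' = G.edge v c' ↔ w = v :=
          ⟨fun h => by rw [← G.invol w c', h, G.invol], fun h => by rw [h]⟩
        simp only [Pi.add_apply, Pi.single_apply, h2, h3]
        exact add_comm _ _
      have h2 := h _ (Submodule.mem_iSup_of_mem c (Submodule.mem_iSup_of_mem hc h1))
      have h3 : f v + f (G.edge v c) = 0 := by
        simpa [D, add_dotProduct] using h2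
      exact (CharTwo.add_eq_zero.1 h3).symm
    · intro hf g hg
      have : (⨆ c ∈ B, invariants G {c}) ≤ LinearMap.ker (D.flip f) :=
        iSup₂_le fun c hc g hg => sum_mul_eq_zero G hg (fun v c' hc' => hf v c' (hc' ▸ hc))
      exact this hg
  have h := LinearMap.BilinForm.finrank_add_finrank_orthogonal' (B := D)
    (⨆ c ∈ B, invariants G {c})
  rwa [hD, inf_bot_eq, finrank_bot, hperp, finrank_invariants, Module.finrank_fintype_fun_eq_card,
    add_zero, ← Nat.card_eq_fintype_card] at h

theorem two_mul_gB_singleton (c : C) : 2 * gB G {c} = Nat.card G.V := by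
  have h := finrank_iSup_invariants G {c}
  rw [iSup_singleton, finrank_invariants] at h
  lia

/-- The distributive law for the spaces of invariants of three involutions expresses the number
of residues over three colors through the numbers of residues over two of them. -/
theorem two_mul_sum_gB_pair {i j k : C} (h : (invariants G {i} ⊔ invariants G {j}) ⊓
    invariants G {k} ≤ invariants G {i, k} ⊔ invariants G {j, k}) :
    2 * (gB G {i, j} + gB G {i, k} + gB G {j, k}) = Nat.card G.V + 4 * gB G {i, j, k} := by
  have hik := invariants_union G {i} {k}
  have hjk := invariants_union G {j} {k}
  have hij := invariants_union G {i} {j}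
  have hijk := invariants_union G {i, k} {j, k}
  rw [show ({i, k} ∪ {j, k} : Set C) = {i, j, k} by ext; simp; tauto] at hijk
  simp only [Set.singleton_union] at hik hjk hij
  have heq : (invariants G {i} ⊔ invariants G {j}) ⊓ invariants G {k} =
      invariants G {i, k} ⊔ invariants G {j, k} :=
    le_antisymm h (hik ▸ hjk ▸ le_inf (sup_le_sup inf_le_left inf_le_left)
      (sup_le inf_le_right inf_le_right))
  have h1 := Submodule.finrank_sup_add_finrank_inf_eq (invariants G {i}) (invariants G {j})
  have h2 := Submodule.finrank_sup_add_finrank_inf_eq (invariants G {i, k}) (invariants G {j, k})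
  have h3 := Submodule.finrank_sup_add_finrank_inf_eq (invariants G {i} ⊔ invariants G {j})
    (invariants G {k})
  have h4 := finrank_iSup_invariants G {i, j, k}
  have hi := two_mul_gB_singleton G i
  have hj := two_mul_gB_singleton G j
  have hk := two_mul_gB_singleton G k
  rw [iSup_insert, iSup_insert, iSup_singleton, ← sup_assoc] at h4
  rw [heq] at h3
  rw [← hijk] at h2
  rw [← hij] at h1
  simp only [finrank_invariants] at h1 h2 h3
  lia

/-- If edge functions on the three colors that are integrable over each pair of colors are
integrable, then the spaces of invariants satisfy the distributive law. -/
theorem invariants_inf_le_of_exists_isPrimitive {i j k : C} (hij : i ≠ j) (hik : i ≠ k)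
    (h : ∀ a : G.V → C → ZMod 2, (∀ Z : Set C, Z ⊂ {i, j, k} → ∃ f, IsPrimitive G Z a f) →
      ∃ f, IsPrimitive G {i, j, k} a f) :
    (invariants G {i} ⊔ invariants G {j}) ⊓ invariants G {k} ≤
      invariants G {i, k} ⊔ invariants G {j, k} := by
  rintro y ⟨hy, hyk⟩
  obtain ⟨u₁, hu₁, u₂, hu₂, rfl⟩ := Submodule.mem_sup.1 hy
  rw [SetLike.mem_coe] at hyk
  simp only [mem_invariants, Set.mem_singleton_iff, forall_eq] at hu₁ hu₂ hyk
  obtain ⟨f, hf⟩ := h (fun v c => if c = i then u₂ (G.edge v c) - u₂ v else 0) (by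
    intro Z hZ
    obtain ⟨c, hc, hcZ⟩ := Set.exists_of_ssubset hZ
    have hZ' := hZ.subset
    simp only [Set.mem_insert_iff, Set.mem_singleton_iff] at hc
    rcases hc with rfl | rfl | rfl
    · refine ⟨0, fun v c' hc' => ?_⟩
      simp [ne_of_mem_of_not_mem hc' hcZ]
    · refine ⟨u₁ + u₂, fun v c' hc' => ?_⟩
      rcases hZ' hc' with rfl | rfl | rfl
      · simp [hu₁]
      · exact absurd hc' hcZ
      · simp [hik.symm, -Pi.add_apply, hyk]
    · refine ⟨u₂, fun v c' hc' => ?_⟩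
      rcases hZ' hc' with rfl | rfl | rfl
      · simp
      · simp [hij.symm, hu₂]
      · exact absurd hc' hcZ)
  refine Submodule.mem_sup.2 ⟨u₁ + u₂ - f, ?_, f, ?_, sub_add_cancel _ _⟩
  · rintro v c (rfl | rfl)
    · have := hf v c (by simp)
      simp only [if_true] at this
      simp only [Pi.sub_apply, Pi.add_apply, this, hu₁]
      ring
    · have := hf v c (by simp)
      simp only [if_neg hik.symm, add_zero] at this
      rw [Pi.sub_apply, Pi.sub_apply, this, hyk]
  · rintro v c (rfl | rfl)
    · simpa [hij.symm] using hf v c (by simp)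
    · simpa [hik.symm] using hf v c (by simp)

end Invariants

theorem IsSingularRep.two_mul_sum_gB_pair {G : CGraph (Fin 5)} (hG : IsSingularRep 4 G)
    {i j k : Fin 5} (hij : i ≠ j) (hik : i ≠ k) (hjk : j ≠ k) :
    2 * (gB G {i, j} + gB G {i, k} + gB G {j, k}) = Nat.card G.V + 4 * gB G {i, j, k} := by
  have hcompl : ∀ i j k : Fin 5, i ≠ j → i ≠ k → j ≠ k →
      ∃ c d, c ≠ d ∧ ∀ x, x = i ∨ x = j ∨ x = k ↔ ¬(x = c ∨ x = d) := by decide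
  obtain ⟨c, d, hcd, h⟩ := hcompl i j k hij hik hjk
  have hset : ({i, j, k} : Set (Fin 5)) = {c, d}ᶜ := Set.ext h
  refine Cryst.two_mul_sum_gB_pair G
    (invariants_inf_le_of_exists_isPrimitive G hij hik fun a ha => ?_)
  rw [hset] at ha ⊢
  exact hG.exists_isPrimitive hcd ha

end Cryst

namespace Cryst

theorem sum_powerset_erase_univ_fin_five (F : Finset (Fin 5) → ℚ) :
    ∑ B ∈ (Finset.univ : Finset (Fin 5)).powerset.erase Finset.univ, (-1 : ℚ) ^ (4 - B.card) * F B =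
      F ∅ - (F {0} + F {1} + F {2} + F {3} + F {4}) +
        (F {0, 1} + F {0, 2} + F {0, 3} + F {0, 4} + F {1, 2} + F {1, 3} + F {1, 4} + F {2, 3} +
          F {2, 4} + F {3, 4}) -
        (F {0, 1, 2} + F {0, 1, 3} + F {0, 1, 4} + F {0, 2, 3} + F {0, 2, 4} + F {0, 3, 4} +
          F {1, 2, 3} + F {1, 2, 4} + F {1, 3, 4} + F {2, 3, 4}) +
        (F {0, 1, 2, 3} + F {0, 1, 2, 4} + F {0, 1, 3, 4} + F {0, 2, 3, 4} + F {1, 2, 3, 4}) := by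
  have h : ((Finset.univ : Finset (Fin 5)).powerset.erase Finset.univ).val =
      ↑[(∅ : Finset (Fin 5)), {0}, {1}, {2}, {3}, {4}, {0, 1}, {0, 2}, {0, 3}, {0, 4}, {1, 2},
        {1, 3}, {1, 4}, {2, 3}, {2, 4}, {3, 4}, {0, 1, 2}, {0, 1, 3}, {0, 1, 4}, {0, 2, 3},
        {0, 2, 4}, {0, 3, 4}, {1, 2, 3}, {1, 2, 4}, {1, 3, 4}, {2, 3, 4}, {0, 1, 2, 3},
        {0, 1, 2, 4}, {0, 1, 3, 4}, {0, 2, 3, 4}, {1, 2, 3, 4}] := by decide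
  rw [Finset.sum_eq_multiset_sum, h]
  simp
  ring

theorem eulerChar_four (G : CGraph (Fin 5)) (ε : Equiv.Perm (Fin 5)) :
    (eulerChar 4 G : ℚ) =
      ∑ B ∈ (Finset.univ : Finset (Fin 5)).powerset.erase Finset.univ,
        (-1 : ℚ) ^ (4 - B.card) * gB G (ε '' ↑B) := by
  rw [eulerChar]
  push_cast
  refine (Finset.sum_equiv ε.finsetCongr (fun B => ?_) (fun B _ => ?_)).symm
  · have h := Finset.map_inj (f := ε.toEmbedding) (s₁ := B) (s₂ := Finset.univ)
    rw [Finset.map_univ_equiv] at h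
    simp [h]
  · simp

theorem pairSet_eq {C : Type} {L : List C} {j : ℕ} {x y : C} (hx : L[j % L.length]? = some x)
    (hy : L[(j + 1) % L.length]? = some y) : pairSet L j = {x, y} := by
  ext c
  simp [pairSet, hx, hy, eq_comm]

theorem rhoL_four {C : Type} (G : CGraph C) (a b c d : C) :
    rhoL G [a, b, c, d] = gB G {a, b, c, d} -
      (gB G {a, b} + gB G {b, c} + gB G {c, d} + gB G {d, a} - (Nat.card G.V : ℚ)) / 2 := by
  have hset : {x | x ∈ [a, b, c, d]} = ({a, b, c, d} : Set C) := by ext; simp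
  simp only [rhoL, hset, List.length_cons, List.length_nil, Finset.sum_range_succ,
    Finset.sum_range_zero, zero_add, pairSet_eq (L := [a, b, c, d]) (j := 0) rfl rfl,
    pairSet_eq (L := [a, b, c, d]) (j := 1) rfl rfl,
    pairSet_eq (L := [a, b, c, d]) (j := 2) rfl rfl,
    pairSet_eq (L := [a, b, c, d]) (j := 3) (x := d) (y := a) rfl (by simp)]
  push_cast
  ring

theorem rhoL_five {C : Type} (G : CGraph C) (a b c d e : C) :
    rhoL G [a, b, c, d, e] = gB G {a, b, c, d, e} -
      (gB G {a, b} + gB G {b, c} + gB G {c, d} + gB G {d, e} + gB G {e, a} -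
        3 / 2 * (Nat.card G.V : ℚ)) / 2 := by
  have hset : {x | x ∈ [a, b, c, d, e]} = ({a, b, c, d, e} : Set C) := by ext; simp
  simp only [rhoL, hset, List.length_cons, List.length_nil, Finset.sum_range_succ,
    Finset.sum_range_zero, zero_add, pairSet_eq (L := [a, b, c, d, e]) (j := 0) rfl rfl,
    pairSet_eq (L := [a, b, c, d, e]) (j := 1) rfl rfl,
    pairSet_eq (L := [a, b, c, d, e]) (j := 2) rfl rfl,
    pairSet_eq (L := [a, b, c, d, e]) (j := 3) rfl rfl,
    pairSet_eq (L := [a, b, c, d, e]) (j := 4) (x := e) (y := a) rfl (by simp)]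
  push_cast
  ring

theorem permList_five (ε : Equiv.Perm (Fin 5)) : permList ε = [ε 0, ε 1, ε 2, ε 3, ε 4] := by
  simp [permList, List.finRange_succ]

theorem sum_rhoL_erase (G : CGraph (Fin 5)) (ε : Equiv.Perm (Fin 5)) :
    ∑ i : Fin 5, rhoL G ((permList ε).erase (ε i)) =
      rhoL G [ε 1, ε 2, ε 3, ε 4] + rhoL G [ε 0, ε 2, ε 3, ε 4] + rhoL G [ε 0, ε 1, ε 3, ε 4] +
        rhoL G [ε 0, ε 1, ε 2, ε 4] + rhoL G [ε 0, ε 1, ε 2, ε 3] := by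
  simp [permList_five, Fin.sum_univ_five, List.erase_cons]

end Cryst

namespace Cryst

/-- for a connected 5-colored graph representing a singular 4-manifold
`N⁴` and each cyclic permutation `ε` of `Δ₄`:
`χ(N⁴) = 2 - 2 ρ_ε(Γ) + Σ_{i ∈ Δ₄} ρ_ε(Γ_{ε̂_i})`. -/
theorem euler_characteristic_formula (G : CGraph (Fin 5)) (hc : Connected G)
    (hG : IsSingularRep 4 G) (ε : Equiv.Perm (Fin 5)) :
    (eulerChar 4 G : ℚ) =
      2 - 2 * rhoL G (permList ε) + ∑ i : Fin 5, rhoL G ((permList ε).erase (ε i)) := by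
  have h1 (i : Fin 5) : 2 * (gB G {ε i} : ℚ) = Nat.card G.V :=
    mod_cast two_mul_gB_singleton G (ε i)
  have h3 (i j k : Fin 5) (hij : i ≠ j) (hik : i ≠ k) (hjk : j ≠ k) :
      2 * ((gB G {ε i, ε j} : ℚ) + gB G {ε i, ε k} + gB G {ε j, ε k}) =
        Nat.card G.V + 4 * gB G {ε i, ε j, ε k} :=
    mod_cast hG.two_mul_sum_gB_pair (ε.injective.ne hij) (ε.injective.ne hik) (ε.injective.ne hjk)
  have h012 := h3 0 1 2 (by decide) (by decide) (by decide)
  have h013 := h3 0 1 3 (by decide) (by decide) (by decide)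
  have h014 := h3 0 1 4 (by decide) (by decide) (by decide)
  have h023 := h3 0 2 3 (by decide) (by decide) (by decide)
  have h024 := h3 0 2 4 (by decide) (by decide) (by decide)
  have h034 := h3 0 3 4 (by decide) (by decide) (by decide)
  have h123 := h3 1 2 3 (by decide) (by decide) (by decide)
  have h124 := h3 1 2 4 (by decide) (by decide) (by decide)
  have h134 := h3 1 3 4 (by decide) (by decide) (by decide)
  have h234 := h3 2 3 4 (by decide) (by decide) (by decide)
  have huniv : ({ε 0, ε 1, ε 2, ε 3, ε 4} : Set (Fin 5)) = Set.univ := by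
    refine Set.eq_univ_of_forall fun x => ?_
    obtain ⟨y, rfl⟩ := ε.surjective x
    fin_cases y <;> simp
  rw [eulerChar_four G ε, sum_powerset_erase_univ_fin_five, sum_rhoL_erase, permList_five]
  simp only [rhoL_four, rhoL_five, huniv, gB_univ G hc, Finset.coe_empty, Finset.coe_insert,
    Finset.coe_singleton, Set.image_empty, Set.image_insert_eq, Set.image_singleton, gB_empty,
    Set.pair_comm (ε 4) (ε 0), Set.pair_comm (ε 4) (ε 1), Set.pair_comm (ε 3) (ε 0)]
  linarith [h1 0, h1 1, h1 2, h1 3, h1 4]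

end Cryst
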